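/- For x ∈ [−1,1], define Z(x) = (√3/2)·₂F₁(−1/6, 1/6; 1/2; x²) − (x/6)·₂F₁(1/3, 2/3; 3/2; x²). Then Z(x) ∈ [1/2, 1] and 4 Z(x)³ − 3 Z(x) = −x; in other words, Z(x) is a root of the cubic equation Z³ − (3/4)Z + x/4 = 0. -/

import Mathlib

/-- Pochhammer symbol `(a)_n = a (a+1) ⋯ (a+n-1)`. -/
noncomputable def pochh (a : ℝ) (n : ℕ) : ℝ := ∏ i ∈ Finset.range n, (a + i)

/-- Gauss hypergeometric series `₂F₁(a,b;c;x)`. -/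
noncomputable def hyp2F1 (a b c x : ℝ) : ℝ :=
  ∑' n : ℕ, pochh a n * pochh b n / (pochh c n * Nat.factorial n) * x ^ n

/-- The sum of the power series with coefficients `c`. -/
noncomputable def powerSum (c : ℕ → ℝ) (x : ℝ) : ℝ := ∑' n, c n * x ^ n

/-- The coefficients of the termwise derivative of a power series. -/
def derivCoeff (c : ℕ → ℝ) (n : ℕ) : ℝ := (n + 1) * c (n + 1)

/-- The sequence `c` grows at most polynomially. -/
def PolyBounded (c : ℕ → ℝ) : Prop := ∃ (C : ℝ) (k : ℕ), ∀ n, |c n| ≤ C * ((n : ℝ) + 1) ^ k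

theorem PolyBounded.derivCoeff {c : ℕ → ℝ} (h : PolyBounded c) : PolyBounded (derivCoeff c) := by
  obtain ⟨C, k, hC⟩ := h
  have hC0 : 0 ≤ C := by
    have := (abs_nonneg _).trans (hC 0)
    simpa using this
  refine ⟨C * 2 ^ k, k + 1, fun n => ?_⟩
  have hn : (0 : ℝ) ≤ n := n.cast_nonneg
  rw [_root_.derivCoeff, abs_mul, abs_of_nonneg (by positivity : (0 : ℝ) ≤ n + 1)]
  calc ((n : ℝ) + 1) * |c (n + 1)| ≤ (n + 1) * (C * (((n + 1 : ℕ) : ℝ) + 1) ^ k) := by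
        gcongr
        exact hC _
    _ ≤ (n + 1) * (C * (2 * ((n : ℝ) + 1)) ^ k) := by
        gcongr
        push_cast
        linarith
    _ = C * 2 ^ k * ((n : ℝ) + 1) ^ (k + 1) := by
        rw [mul_pow]
        ring

theorem PolyBounded.natCast_mul {c : ℕ → ℝ} (h : PolyBounded c) :
    PolyBounded fun n => n * c n := by
  obtain ⟨C, k, hC⟩ := h
  refine ⟨C, k + 1, fun n => ?_⟩
  have hn : (0 : ℝ) ≤ n := n.cast_nonneg
  rw [abs_mul, abs_of_nonneg hn]
  calc (n : ℝ) * |c n| ≤ (n + 1) * (C * ((n : ℝ) + 1) ^ k) := by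
        gcongr
        · linarith
        · exact hC n
    _ = C * ((n : ℝ) + 1) ^ (k + 1) := by ring

theorem PolyBounded.summable {c : ℕ → ℝ} (h : PolyBounded c) {r : ℝ} (hr : |r| < 1) :
    Summable fun n => c n * r ^ n := by
  obtain ⟨C, k, hC⟩ := h
  by_cases hr0 : r = 0
  · refine summable_of_ne_finset_zero (s := {0}) fun n hn => ?_
    simp_all
  have hs : Summable fun n : ℕ => ((n + 1 : ℕ) : ℝ) ^ k * |r| ^ (n + 1) :=
    (summable_nat_add_iff (f := fun n : ℕ => (n : ℝ) ^ k * |r| ^ n) 1).2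
      (summable_pow_mul_geometric_of_norm_lt_one k (by simpa using hr))
  refine Summable.of_norm_bounded (hs.mul_left (C / |r|)) fun n => ?_
  have hr0' : |r| ≠ 0 := by simpa using hr0
  rw [Real.norm_eq_abs, abs_mul, abs_pow]
  calc |c n| * |r| ^ n ≤ C * ((n : ℝ) + 1) ^ k * |r| ^ n := by
        gcongr
        exact hC n
    _ = C / |r| * (((n + 1 : ℕ) : ℝ) ^ k * |r| ^ (n + 1)) := by
        push_cast
        rw [pow_succ]
        field_simp

theorem PolyBounded.mul_powerSum_derivCoeff {c : ℕ → ℝ} (h : PolyBounded c) {x : ℝ}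
    (hx : |x| < 1) : x * powerSum (_root_.derivCoeff c) x = powerSum (fun n => n * c n) x := by
  simp only [powerSum]
  rw [(h.natCast_mul.summable hx).tsum_eq_zero_add, ← tsum_mul_left]
  simp only [Nat.cast_zero, zero_mul, zero_add]
  refine tsum_congr fun n => ?_
  rw [_root_.derivCoeff]
  push_cast
  ring

theorem PolyBounded.hasDerivAt_powerSum {c : ℕ → ℝ} (h : PolyBounded c) {x : ℝ} (hx : |x| < 1) :
    HasDerivAt (powerSum c) (powerSum (_root_.derivCoeff c) x) x := by
  obtain ⟨r, hxr, hr1⟩ := exists_between hx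
  have hr0 : 0 < r := (abs_nonneg x).trans_lt hxr
  have hr : |r| < 1 := by rwa [abs_of_pos hr0]
  have key := hasDerivAt_tsum_of_isPreconnected (𝕜 := ℝ)
    (g := fun n x => c n * x ^ n) (g' := fun n x => c n * (n * x ^ (n - 1)))
    (u := fun n => |c n * (n * r ^ (n - 1))|) (t := Metric.ball 0 r) (y₀ := x) (y := x)
    ?_ Metric.isOpen_ball (convex_ball _ _).isPreconnected ?_ ?_ (by simpa using hxr)
    (h.summable hx) (by simpa using hxr)
  · refine key.congr_deriv ?_
    have hs := (summable_nat_add_iff (f := fun n => c n * (n * x ^ (n - 1))) 1).1 (by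
      refine (h.derivCoeff.summable hx).congr fun n => ?_
      simp only [_root_.derivCoeff, Nat.add_sub_cancel, Nat.cast_add, Nat.cast_one]
      ring)
    rw [hs.tsum_eq_zero_add]
    simp only [powerSum, _root_.derivCoeff, Nat.add_sub_cancel, Nat.cast_add, Nat.cast_one,
      Nat.cast_zero, zero_mul, mul_zero, zero_add]
    refine tsum_congr fun n => ?_
    ring
  · refine (summable_nat_add_iff 1).1 ((h.derivCoeff.summable hr).abs.congr fun n => ?_)
    simp only [_root_.derivCoeff, Nat.add_sub_cancel, Nat.cast_add, Nat.cast_one]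
    congr 1
    ring
  · intro n y _
    exact (hasDerivAt_pow n y).const_mul (c n)
  · intro n y hy
    have hy' : |y| ≤ r := by simpa using (Metric.mem_ball.1 hy).le
    simp only [Real.norm_eq_abs, abs_mul, abs_pow]
    rw [abs_of_pos hr0]
    gcongr

/-- The coefficients of a power series solution of `(1 - x²) y'' - x y' + a² y = 0`. -/
def ArcsinRecurrence (a : ℝ) (c : ℕ → ℝ) : Prop :=
  ∀ n : ℕ, ((n : ℝ) + 1) * (n + 2) * c (n + 2) = ((n : ℝ) ^ 2 - a ^ 2) * c n

namespace ArcsinRecurrence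

variable {a : ℝ} {c : ℕ → ℝ}

theorem summable_abs (h : ArcsinRecurrence a c) (ha : |a| ≤ 1) : Summable fun n => |c n| := by
  have ha2 : a ^ 2 ≤ 1 := by rwa [sq_le_one_iff_abs_le_one]
  have step (n : ℕ) : |c (n + 1)| + 2 * ((n + 3) * |c (n + 3)|) ≤ 2 * ((n + 1) * |c (n + 1)|) := by
    have hn : (0 : ℝ) ≤ n := n.cast_nonneg
    have hrec := congrArg abs (h (n + 1))
    have hpos : 0 ≤ ((n : ℝ) + 1) ^ 2 - a ^ 2 := by nlinarith
    push_cast at hrec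
    rw [abs_mul, abs_mul _ (c (n + 1)), abs_of_nonneg hpos, abs_of_nonneg (by positivity), show n + 1 + 2 = n + 3 from rfl] at hrec
    have hc := abs_nonneg (c (n + 1))
    refine le_of_mul_le_mul_left ?_ (by positivity : (0 : ℝ) < n + 2)
    nlinarith [mul_nonneg hn hc, mul_nonneg (sq_nonneg a) hc]
  have bound (N : ℕ) : ∑ n ∈ Finset.range N, |c (n + 1)| +
      (2 * ((N + 1) * |c (N + 1)|) + 2 * ((N + 2) * |c (N + 2)|)) ≤
      2 * |c 1| + 4 * |c 2| := by
    induction N with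
    | zero => norm_num; linarith
    | succ N ih =>
      rw [Finset.sum_range_succ]
      have := step N
      push_cast
      rw [show N + 1 + 2 = N + 3 from rfl, show N + 1 + 1 = N + 2 from rfl]
      linarith
  refine (summable_nat_add_iff 1).1
    (summable_of_sum_range_le (c := 2 * |c 1| + 4 * |c 2|) (fun n => abs_nonneg _) fun N => ?_)
  refine le_trans ?_ (bound N)
  have : 0 ≤ 2 * (((N : ℝ) + 1) * |c (N + 1)|) + 2 * ((N + 2) * |c (N + 2)|) := by positivity
  linarith

theorem polyBounded (h : ArcsinRecurrence a c) (ha : |a| ≤ 1) : PolyBounded c :=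
  ⟨∑' n, |c n|, 0, fun n => by
    simpa using (h.summable_abs ha).le_tsum n fun _ _ => abs_nonneg _⟩

theorem abs_mul_pow_le {x : ℝ} (hx : x ∈ Set.Icc (-1 : ℝ) 1) (n : ℕ) :
    ‖c n * x ^ n‖ ≤ |c n| := by
  rw [Real.norm_eq_abs, abs_mul, abs_pow]
  exact mul_le_of_le_one_right (abs_nonneg _) (pow_le_one₀ (abs_nonneg _) (abs_le.2 hx))

theorem ode (h : ArcsinRecurrence a c) (ha : |a| ≤ 1) {x : ℝ} (hx : |x| < 1) :
    (1 - x ^ 2) * powerSum (derivCoeff (derivCoeff c)) x - x * powerSum (derivCoeff c) x =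
      -a ^ 2 * powerSum c x := by
  have hb := h.polyBounded ha
  have e1 := hb.mul_powerSum_derivCoeff hx
  have e2 := hb.derivCoeff.mul_powerSum_derivCoeff hx
  have e3 := hb.natCast_mul.mul_powerSum_derivCoeff hx
  have e4 : powerSum (derivCoeff fun n => n * c n) x =
      powerSum (fun n => n * derivCoeff c n) x + powerSum (derivCoeff c) x := by
    simp only [powerSum]
    rw [← (hb.derivCoeff.natCast_mul.summable hx).tsum_add (hb.derivCoeff.summable hx)]
    refine tsum_congr fun n => ?_
    simp only [derivCoeff]
    push_cast
    ring
  have e5 : powerSum (derivCoeff (derivCoeff c)) x =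
      powerSum (fun n => n * (n * c n)) x - a ^ 2 * powerSum c x := by
    simp only [powerSum]
    rw [← tsum_mul_left, ← (hb.natCast_mul.natCast_mul.summable hx).tsum_sub
      ((hb.summable hx).mul_left _)]
    refine tsum_congr fun n => ?_
    simp only [derivCoeff]
    push_cast
    linear_combination x ^ n * h n
  linear_combination e5 - e3 + x * e4 - x * e2

theorem powerSum_sin (h : ArcsinRecurrence a c) (ha : |a| ≤ 1) (ha0 : a ≠ 0) {t : ℝ}
    (ht : t ∈ Set.Ioo (-(Real.pi / 2)) (Real.pi / 2)) :
    powerSum c (Real.sin t) = c 0 * Real.cos (a * t) + c 1 / a * Real.sin (a * t) := by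
  have hb := h.polyBounded ha
  have abs_sin_lt {s : ℝ} (hs : s ∈ Set.Ioo (-(Real.pi / 2)) (Real.pi / 2)) :
      |Real.sin s| < 1 := by
    rw [← sq_lt_one_iff_abs_lt_one, Real.sin_sq]
    linarith [pow_pos (Real.cos_pos_of_mem_Ioo hs) 2]
  let g (s : ℝ) : ℝ := powerSum c (Real.sin s)
  let g' (s : ℝ) : ℝ := powerSum (derivCoeff c) (Real.sin s) * Real.cos s
  have dg {s : ℝ} (hs : s ∈ Set.Ioo (-(Real.pi / 2)) (Real.pi / 2)) : HasDerivAt g (g' s) s :=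
    (hb.hasDerivAt_powerSum (abs_sin_lt hs)).comp s (Real.hasDerivAt_sin s)
  have dg' {s : ℝ} (hs : s ∈ Set.Ioo (-(Real.pi / 2)) (Real.pi / 2)) :
      HasDerivAt g' (-a ^ 2 * g s) s := by
    refine (((hb.derivCoeff.hasDerivAt_powerSum (abs_sin_lt hs)).comp s
      (Real.hasDerivAt_sin s)).mul (Real.hasDerivAt_cos s)).congr_deriv ?_
    simp only [g, Function.comp]
    rw [← h.ode ha (abs_sin_lt hs), ← Real.cos_sq']
    ring
  have dcos (s : ℝ) : HasDerivAt (fun s => Real.cos (a * s)) (-Real.sin (a * s) * a) s := by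
    simpa using ((hasDerivAt_id s).const_mul a).cos
  have dsin (s : ℝ) : HasDerivAt (fun s => Real.sin (a * s)) (Real.cos (a * s) * a) s := by
    simpa using ((hasDerivAt_id s).const_mul a).sin
  have h0 : (0 : ℝ) ∈ Set.Ioo (-(Real.pi / 2)) (Real.pi / 2) := by
    constructor <;> linarith [Real.pi_pos]
  have const {u : ℝ → ℝ} (hu : ∀ s ∈ Set.Ioo (-(Real.pi / 2)) (Real.pi / 2), HasDerivAt u 0 s) :
      u t = u 0 :=
    isOpen_Ioo.is_const_of_deriv_eq_zero isPreconnected_Ioo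
      (fun s hs => (hu s hs).differentiableAt.differentiableWithinAt)
      (fun s hs => (hu s hs).deriv) ht h0
  have hu := const (u := fun s => a * (g s * Real.cos (a * s)) - g' s * Real.sin (a * s))
    fun s hs => by
      refine ((((dg hs).mul (dcos s)).const_mul a).sub ((dg' hs).mul (dsin s))).congr_deriv ?_
      ring
  have hv := const (u := fun s => a * (g s * Real.sin (a * s)) + g' s * Real.cos (a * s))
    fun s hs => by
      refine ((((dg hs).mul (dsin s)).const_mul a).add ((dg' hs).mul (dcos s))).congr_deriv ?_
      ring
  have powerSum_zero (d : ℕ → ℝ) : powerSum d 0 = d 0 := by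
    rw [powerSum, tsum_eq_single 0 fun n hn => by simp [hn]]
    simp
  simp only [g, g', Real.sin_zero, Real.cos_zero, mul_zero, mul_one, sub_zero, zero_add,
    powerSum_zero, derivCoeff, Nat.cast_zero, one_mul] at hu hv
  field_simp
  linear_combination Real.cos (a * t) * hu + Real.sin (a * t) * hv -
    a * powerSum c (Real.sin t) * Real.sin_sq_add_cos_sq (a * t)

theorem powerSum_eq (h : ArcsinRecurrence a c) (ha : |a| ≤ 1) (ha0 : a ≠ 0) {x : ℝ}
    (hx : x ∈ Set.Icc (-1 : ℝ) 1) :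
    powerSum c x =
      c 0 * Real.cos (a * Real.arcsin x) + c 1 / a * Real.sin (a * Real.arcsin x) := by
  have hcont : ContinuousOn (powerSum c) (Set.Icc (-1) 1) :=
    continuousOn_tsum (fun n => by fun_prop) (h.summable_abs ha) fun n y hy => abs_mul_pow_le hy n
  have hcont' : Continuous fun x => c 0 * Real.cos (a * Real.arcsin x) +
      c 1 / a * Real.sin (a * Real.arcsin x) := by
    have := Real.continuous_arcsin
    fun_prop
  have hopen : Set.EqOn (powerSum c) (fun x => c 0 * Real.cos (a * Real.arcsin x) +
      c 1 / a * Real.sin (a * Real.arcsin x)) (Set.Ioo (-1) 1) := fun y hy => by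
    have := h.powerSum_sin ha ha0 (t := Real.arcsin y)
      ⟨Real.neg_pi_div_two_lt_arcsin.2 hy.1, Real.arcsin_lt_pi_div_two.2 hy.2⟩
    rwa [Real.sin_arcsin hy.1.le hy.2.le] at this
  refine hopen.of_subset_closure hcont hcont'.continuousOn Set.Ioo_subset_Icc_self ?_ hx
  rw [closure_Ioo (by norm_num)]

end ArcsinRecurrence

/-- The coefficients of the Gauss hypergeometric series. -/
noncomputable def hypCoeff (a b c : ℝ) (n : ℕ) : ℝ :=
  pochh a n * pochh b n / (pochh c n * Nat.factorial n)

theorem hypCoeff_zero (a b c : ℝ) : hypCoeff a b c 0 = 1 := by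
  simp [hypCoeff, pochh]

theorem hypCoeff_succ (a b : ℝ) {c : ℝ} (hc : 0 < c) (n : ℕ) :
    (c + n) * (n + 1) * hypCoeff a b c (n + 1) = (a + n) * (b + n) * hypCoeff a b c n := by
  have h1 : pochh c n ≠ 0 := (Finset.prod_pos fun i _ => by positivity).ne'
  have h2 : c + n ≠ 0 := by positivity
  have h3 : (n : ℝ) + 1 ≠ 0 := by positivity
  have h4 : (Nat.factorial n : ℝ) ≠ 0 := by positivity
  have pochh_succ (d : ℝ) : pochh d (n + 1) = pochh d n * (d + n) := Finset.prod_range_succ _ _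
  simp only [hypCoeff, pochh_succ, Nat.factorial_succ]
  push_cast
  field_simp

/-- The Taylor coefficients of `√3 / 2 * cos (arcsin x / 3) - 1 / 2 * sin (arcsin x / 3)`. -/
noncomputable def cubicRootCoeff (n : ℕ) : ℝ :=
  if Even n then Real.sqrt 3 / 2 * hypCoeff (-(1 / 6)) (1 / 6) (1 / 2) (n / 2)
  else -(1 / 6) * hypCoeff (1 / 3) (2 / 3) (3 / 2) (n / 2)

theorem cubicRootCoeff_even (m : ℕ) : cubicRootCoeff (2 * m) =
    Real.sqrt 3 / 2 * hypCoeff (-(1 / 6)) (1 / 6) (1 / 2) m := by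
  simp [cubicRootCoeff]

theorem cubicRootCoeff_odd (m : ℕ) : cubicRootCoeff (2 * m + 1) =
    -(1 / 6) * hypCoeff (1 / 3) (2 / 3) (3 / 2) m := by
  rw [cubicRootCoeff, if_neg (by simp), show (2 * m + 1) / 2 = m by omega]

theorem arcsinRecurrence_cubicRootCoeff : ArcsinRecurrence (1 / 3) cubicRootCoeff := by
  intro n
  obtain ⟨m, rfl | rfl⟩ := n.even_or_odd'
  · rw [show 2 * m + 2 = 2 * (m + 1) by ring, cubicRootCoeff_even, cubicRootCoeff_even]
    push_cast
    linear_combination 2 * Real.sqrt 3 *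
      hypCoeff_succ (-(1 / 6)) (1 / 6) (c := 1 / 2) (by norm_num) m
  · rw [show 2 * m + 1 + 2 = 2 * (m + 1) + 1 by ring, cubicRootCoeff_odd, cubicRootCoeff_odd]
    push_cast
    linear_combination -(2 / 3) *
      hypCoeff_succ (1 / 3) (2 / 3) (c := 3 / 2) (by norm_num) m

theorem powerSum_cubicRootCoeff {x : ℝ} (hx : x ∈ Set.Icc (-1 : ℝ) 1) :
    powerSum cubicRootCoeff x =
      Real.sqrt 3 / 2 * hyp2F1 (-(1 / 6)) (1 / 6) (1 / 2) (x ^ 2) -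
        x / 6 * hyp2F1 (1 / 3) (2 / 3) (3 / 2) (x ^ 2) := by
  have hs : Summable fun n => cubicRootCoeff n * x ^ n :=
    Summable.of_norm_bounded
      (arcsinRecurrence_cubicRootCoeff.summable_abs (by norm_num [abs_of_pos]))
      (ArcsinRecurrence.abs_mul_pow_le hx)
  have he : Summable fun k => cubicRootCoeff (2 * k) * x ^ (2 * k) :=
    hs.comp_injective (mul_right_injective₀ two_ne_zero)
  have ho : Summable fun k => cubicRootCoeff (2 * k + 1) * x ^ (2 * k + 1) :=
    hs.comp_injective ((add_left_injective 1).comp (mul_right_injective₀ two_ne_zero))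
  have hsum := tsum_even_add_odd (f := fun n => cubicRootCoeff n * x ^ n) he ho
  rw [powerSum, ← hsum, sub_eq_add_neg, ← neg_mul, hyp2F1, hyp2F1,
    ← tsum_mul_left, ← tsum_mul_left]
  congr 1 <;> refine tsum_congr fun m => ?_
  · rw [cubicRootCoeff_even, hypCoeff, pow_mul]
    ring
  · rw [cubicRootCoeff_odd, hypCoeff, pow_succ, pow_mul]
    ring

theorem stmt14 (x : ℝ) (hx : x ∈ Set.Icc (-1 : ℝ) 1) (Z : ℝ)
    (hZ : Z = Real.sqrt 3 / 2 * hyp2F1 (-(1 / 6)) (1 / 6) (1 / 2) (x ^ 2) -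
      x / 6 * hyp2F1 (1 / 3) (2 / 3) (3 / 2) (x ^ 2)) :
    Z ∈ Set.Icc (1 / 2 : ℝ) 1 ∧ 4 * Z ^ 3 - 3 * Z = -x := by
  have h0 : cubicRootCoeff 0 = Real.sqrt 3 / 2 := by
    simpa [hypCoeff_zero] using cubicRootCoeff_even 0
  have h1 : cubicRootCoeff 1 = -(1 / 6) := by
    simpa [hypCoeff_zero] using cubicRootCoeff_odd 0
  have hcos : Z = Real.cos (1 / 3 * Real.arcsin x + Real.pi / 6) := by
    rw [hZ, ← powerSum_cubicRootCoeff hx, arcsinRecurrence_cubicRootCoeff.powerSum_eq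
      (by norm_num [abs_of_pos]) (by norm_num) hx, h0, h1, Real.cos_add, Real.cos_pi_div_six,
      Real.sin_pi_div_six]
    ring
  have hle := Real.arcsin_le_pi_div_two x
  have hge := Real.neg_pi_div_two_le_arcsin x
  refine ⟨⟨?_, hcos ▸ Real.cos_le_one _⟩, ?_⟩
  · rw [hcos, ← Real.cos_pi_div_three]
    exact Real.cos_le_cos_of_nonneg_of_le_pi (by linarith) (by linarith [Real.pi_pos])
      (by linarith)
  · rw [hcos, ← Real.cos_three_mul,
      show 3 * (1 / 3 * Real.arcsin x + Real.pi / 6) = Real.arcsin x + Real.pi / 2 by ring,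
      Real.cos_add_pi_div_two, Real.sin_arcsin hx.1 hx.2]
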